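/- Let a : ℕ → ℝ with a_n > 0 for all n and b : ℕ → ℂ. Then J(a,b)* = J(a,b*) if and only if J(a,b) is proper, i.e. if and only if the closure of the minimal operator J₀(a,b) equals the maximal operator J(a,b). -/

import Mathlib

open scoped InnerProductSpace ComplexConjugate

noncomputable section

/-- The Hilbert space `ℓ²(ℕ₀)` of square-summable complex sequences. -/
abbrev H : Type := lp (fun _ : ℕ => ℂ) 2

/-- The formal Jacobi action: `(Ju)ₙ = aₙ₋₁uₙ₋₁ + bₙuₙ + aₙuₙ₊₁` (with `u₋₁ = 0`). -/
def jacobiAct (a : ℕ → ℝ) (b : ℕ → ℂ) (u : ℕ → ℂ) : ℕ → ℂ := fun n =>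
  (if n = 0 then 0 else (a (n - 1) : ℂ) * u (n - 1)) + b n * u n + (a n : ℂ) * u (n + 1)

lemma jacobiAct_add (a : ℕ → ℝ) (b : ℕ → ℂ) (u v : ℕ → ℂ) :
    jacobiAct a b (u + v) = jacobiAct a b u + jacobiAct a b v := by
  funext n
  by_cases h : n = 0 <;> simp [jacobiAct, h] <;> ring

lemma jacobiAct_smul (a : ℕ → ℝ) (b : ℕ → ℂ) (c : ℂ) (u : ℕ → ℂ) :
    jacobiAct a b (c • u) = c • jacobiAct a b u := by
  funext n
  by_cases h : n = 0 <;> simp [jacobiAct, h] <;> ring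

lemma jacobiAct_zero (a : ℕ → ℝ) (b : ℕ → ℂ) : jacobiAct a b 0 = 0 := by
  funext n
  by_cases h : n = 0 <;> simp [jacobiAct, h]

/-- The domain of the maximal Jacobi operator: all `u ∈ ℓ²` whose formal Jacobi action is
again in `ℓ²`. -/
def jacobiDomain (a : ℕ → ℝ) (b : ℕ → ℂ) : Submodule ℂ H where
  carrier := {u : H | Memℓp (jacobiAct a b ⇑u) 2}
  zero_mem' := by
    show Memℓp (jacobiAct a b 0) 2
    rw [jacobiAct_zero]
    exact zero_memℓp (E := fun _ : ℕ => ℂ) (p := 2)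
  add_mem' := by
    intro u v hu hv
    show Memℓp (jacobiAct a b ((⇑u : ℕ → ℂ) + (⇑v : ℕ → ℂ))) 2
    rw [jacobiAct_add]
    exact Memℓp.add hu hv
  smul_mem' := by
    intro c u hu
    simpa [lp.coeFn_smul, jacobiAct_smul] using hu.const_smul c

/-- The maximal Jacobi operator `J(a,b)`, as a partially defined linear operator on
`ℓ²(ℕ₀)`. -/
def jacobiOp (a : ℕ → ℝ) (b : ℕ → ℂ) : H →ₗ.[ℂ] H where
  domain := jacobiDomain a b
  toFun :=
    { toFun := fun u => (⟨jacobiAct a b ⇑(u : H), u.2⟩ : H)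
      map_add' := by
        intro u v
        apply Subtype.ext
        exact jacobiAct_add a b _ _
      map_smul' := by
        intro c u
        apply Subtype.ext
        exact jacobiAct_smul a b c _ }

/-- The subspace `ℓ²_c(ℕ₀)` of finitely supported sequences. -/
def finSupp : Submodule ℂ H where
  carrier := {u : H | (Function.support ⇑u).Finite}
  zero_mem' := by simp [Function.support]
  add_mem' := by
    intro u v hu hv
    refine Set.Finite.subset (hu.union hv) ?_
    intro n hn
    simp only [Function.mem_support, lp.coeFn_add, Pi.add_apply] at hn
    by_contra hc
    simp only [Set.mem_union, Function.mem_support, not_or, not_not] at hc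
    exact hn (by rw [hc.1, hc.2, add_zero])
  smul_mem' := by
    intro c u hu
    refine Set.Finite.subset hu ?_
    intro n hn
    simp only [Function.mem_support, lp.coeFn_smul, Pi.smul_apply, smul_eq_mul] at hn
    simp only [Function.mem_support]
    intro h
    exact hn (by rw [h, mul_zero])

lemma finSupp_memℓp (a : ℕ → ℝ) (b : ℕ → ℂ) (u : ℕ → ℂ)
    (hu : (Function.support u).Finite) : Memℓp (jacobiAct a b u) 2 := by
  have hfin : (((· + 1) '' Function.support u ∪ Function.support u) ∪
      ((· - 1) '' Function.support u)).Finite :=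
    ((hu.image _).union hu).union (hu.image _)
  refine (memℓp_zero (hfin.subset ?_)).of_exponent_ge zero_le
  intro n hn
  simp only [Set.mem_setOf_eq, jacobiAct] at hn
  by_contra hc
  simp only [Set.mem_union, Set.mem_image, Function.mem_support, not_or, not_exists,
    not_and] at hc
  obtain ⟨⟨h1, h2⟩, h3⟩ := hc
  have e2 : u n = 0 := not_not.1 h2
  have e3 : u (n + 1) = 0 := by
    by_contra hne
    exact h3 (n + 1) hne (by omega)
  apply hn
  by_cases h : n = 0
  · subst h; simp [e2, show u 1 = 0 from e3]
  · have e1 : u (n - 1) = 0 := by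
      by_contra hne
      exact h1 (n - 1) hne (by omega)
    simp [h, e1, e2, e3]

/-- The minimal Jacobi operator `J₀(a,b)`: the restriction of the maximal operator to the
finitely supported sequences. -/
def jacobiOp₀ (a : ℕ → ℝ) (b : ℕ → ℂ) : H →ₗ.[ℂ] H where
  domain := finSupp
  toFun :=
    { toFun := fun u => (⟨jacobiAct a b ⇑(u : H), finSupp_memℓp a b _ u.2⟩ : H)
      map_add' := by
        intro u v
        apply Subtype.ext
        exact jacobiAct_add a b _ _
      map_smul' := by
        intro c u
        apply Subtype.ext
        exact jacobiAct_smul a b c _ }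

/-- The Wronskian `Wₙ(u,v) = aₙ(uₙ₊₁vₙ − uₙvₙ₊₁)`. -/
def wronskian (a : ℕ → ℝ) (u v : ℕ → ℂ) (n : ℕ) : ℂ :=
  (a n : ℂ) * (u (n + 1) * v n - u n * v (n + 1))


section AdjointRelation

variable {𝕜 E F : Type*} [RCLike 𝕜] [NormedAddCommGroup E] [InnerProductSpace 𝕜 E]
  [NormedAddCommGroup F] [InnerProductSpace 𝕜 F]

lemma Submodule.isClosed_adjoint (g : Submodule 𝕜 (E × F)) :
    IsClosed (g.adjoint : Set (F × E)) := by
  rw [Submodule.adjoint, Submodule.map_coe, LinearEquiv.coe_coe,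
    LinearEquiv.image_eq_preimage_symm]
  exact (Submodule.isClosed_orthogonal _).preimage (WithLp.prod_continuous_toLp _ _ _)

/-- The double adjoint of a linear relation between Hilbert spaces is its closure. -/
lemma Submodule.adjoint_adjoint [CompleteSpace E] [CompleteSpace F]
    (g : Submodule 𝕜 (E × F)) : g.adjoint.adjoint = g.topologicalClosure := by
  let e := (WithLp.prodContinuousLinearEquiv 2 𝕜 E F).symm
  let K : Submodule 𝕜 (WithLp 2 (E × F)) := g.map (e : E × F →ₗ[𝕜] WithLp 2 (E × F))
  have mem_orthogonal (a : F) (b : E) :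
      WithLp.toLp 2 (b, -a) ∈ Kᗮ ↔ (a, b) ∈ g.adjoint := by
    simp only [Submodule.mem_orthogonal, K, Submodule.mem_map, Submodule.mem_adjoint_iff]
    constructor
    · intro h c d hcd
      have := h _ ⟨(c, d), hcd, rfl⟩
      simp only [WithLp.prod_inner_apply, e, inner_neg_right] at this
      exact (neg_eq_zero.1 (by rw [← this]; simp; ring))
    · rintro h _ ⟨⟨c, d⟩, hcd, rfl⟩
      have := h c d hcd
      rw [← neg_eq_zero, ← this]
      simp [e, sub_eq_add_neg]
  ext x
  have hx : x ∈ g.adjoint.adjoint ↔ e x ∈ Kᗮᗮ := by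
    rw [Submodule.mem_adjoint_iff, Submodule.mem_orthogonal]
    constructor
    · intro h y hy
      have := h (-y.snd) y.fst ((mem_orthogonal _ _).1 (by rwa [neg_neg]))
      simpa [e] using this
    · intro h a b hab
      have := h _ ((mem_orthogonal a b).2 hab)
      simpa [e, sub_eq_add_neg] using this
  rw [hx, Submodule.orthogonal_orthogonal_eq_closure, ← SetLike.mem_coe, ← SetLike.mem_coe,
    Submodule.topologicalClosure_coe, Submodule.topologicalClosure_coe]
  have himage : (K : Set (WithLp 2 (E × F))) = e '' g := rfl
  rw [himage, ← e.image_closure, e.injective.mem_set_image]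

lemma Submodule.adjoint_topologicalClosure [CompleteSpace E] [CompleteSpace F]
    (g : Submodule 𝕜 (E × F)) : g.topologicalClosure.adjoint = g.adjoint := by
  rw [← g.adjoint_adjoint, g.adjoint.adjoint_adjoint,
    g.isClosed_adjoint.submodule_topologicalClosure_eq]

end AdjointRelation

/-- Summation by parts for the formal Jacobi action. -/
lemma sum_range_jacobiAct_inner (a : ℕ → ℝ) (b : ℕ → ℂ) (u v : ℕ → ℂ) (N : ℕ) :
    ∑ n ∈ Finset.range (N + 1), ⟪jacobiAct a b u n, v n⟫_ℂ =
      ∑ n ∈ Finset.range (N + 1), ⟪u n, jacobiAct a (fun n => conj (b n)) v n⟫_ℂ +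
        wronskian a (fun n => conj (u n)) v N := by
  induction N with
  | zero => simp [jacobiAct, wronskian]; ring
  | succ N ih =>
    rw [Finset.sum_range_succ, ih, Finset.sum_range_succ _ (N + 1)]
    simp [jacobiAct, wronskian]
    ring

lemma inner_jacobiOp₀_left (a : ℕ → ℝ) (b : ℕ → ℂ) (u : (jacobiOp₀ a b).domain) (v : H) :
    ⟪jacobiOp₀ a b u, v⟫_ℂ =
      ∑' n, ⟪(u : H) n, jacobiAct a (fun n => conj (b n)) v n⟫_ℂ := by
  have hu : (Function.support ⇑(u : H)).Finite := u.2
  obtain ⟨N, hN⟩ := hu.bddAbove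
  have hzero (n : ℕ) (hn : N < n) : (u : H) n = 0 := by
    by_contra h
    exact absurd (hN h) (by omega)
  have hact (n : ℕ) (hn : N + 1 < n) : jacobiAct a b (u : H) n = 0 := by
    simp [jacobiAct, hzero n (by omega), hzero (n - 1) (by omega), hzero (n + 1) (by omega)]
  rw [lp.inner_eq_tsum, tsum_eq_sum (s := Finset.range (N + 1 + 1)),
    tsum_eq_sum (s := Finset.range (N + 1 + 1))]
  · refine (sum_range_jacobiAct_inner a b (u : H) v (N + 1)).trans ?_
    simp [wronskian, hzero (N + 1) (by omega), hzero (N + 1 + 1) (by omega)]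
  · intro n hn
    rw [hzero n (by simp at hn; omega), inner_zero_left]
  · intro n hn
    change ⟪jacobiAct a b (u : H) n, v n⟫_ℂ = 0
    rw [hact n (by simp at hn; omega), inner_zero_left]

lemma single_mem_finSupp (n : ℕ) (c : ℂ) : (lp.single 2 n c : H) ∈ finSupp :=
  (Set.finite_singleton n).subset (by
    rw [lp.coeFn_single]
    exact Pi.support_single_subset)

lemma dense_finSupp : Dense (finSupp : Set H) := fun u =>
  mem_closure_of_tendsto (lp.hasSum_single ENNReal.ofNat_ne_top u)
    (Filter.Eventually.of_forall fun _ => finSupp.sum_mem fun n _ => single_mem_finSupp n (u n))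

lemma jacobiOp₀_le_jacobiOp (a : ℕ → ℝ) (b : ℕ → ℂ) : jacobiOp₀ a b ≤ jacobiOp a b :=
  ⟨fun u hu => finSupp_memℓp a b u hu, fun u v huv => by
    apply Subtype.ext
    change jacobiAct a b (u : H) = jacobiAct a b (v : H)
    rw [huv]⟩

lemma dense_jacobiOp_domain (a : ℕ → ℝ) (b : ℕ → ℂ) : Dense ((jacobiOp a b).domain : Set H) :=
  dense_finSupp.mono (jacobiOp₀_le_jacobiOp a b).1

/-- The adjoint of the minimal operator is the maximal operator with conjugated coefficients. -/
lemma adjoint_graph_jacobiOp₀ (a : ℕ → ℝ) (b : ℕ → ℂ) :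
    (jacobiOp₀ a b).graph.adjoint = (jacobiOp a (fun n => conj (b n))).graph := by
  ext ⟨v, w⟩
  rw [Submodule.mem_adjoint_iff]
  constructor
  · intro h
    have hw : jacobiAct a (fun n => conj (b n)) v = w := by
      funext n
      let u : (jacobiOp₀ a b).domain := ⟨lp.single 2 n 1, single_mem_finSupp n 1⟩
      have hu := sub_eq_zero.1 (h _ _ ((jacobiOp₀ a b).mem_graph u))
      rw [inner_jacobiOp₀_left, tsum_eq_single n, lp.inner_single_left] at hu
      · simpa [u] using hu
      · intro m hm
        simp [u, hm]
    have hv : v ∈ jacobiDomain a (fun n => conj (b n)) := by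
      change Memℓp (jacobiAct a _ v) 2
      rw [hw]
      exact lp.memℓp w
    exact (LinearPMap.mem_graph_iff _).2 ⟨⟨v, hv⟩, rfl, Subtype.ext hw⟩
  · intro h c d hcd
    obtain ⟨u, rfl, rfl⟩ := (LinearPMap.mem_graph_iff _).1 hcd
    obtain ⟨v', hv, rfl⟩ := (LinearPMap.mem_graph_iff _).1 h
    dsimp only at hv ⊢
    subst hv
    rw [inner_jacobiOp₀_left, lp.inner_eq_tsum, sub_eq_zero]
    rfl

lemma isClosed_jacobiOp (a : ℕ → ℝ) (b : ℕ → ℂ) : (jacobiOp a b).IsClosed := by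
  have h := adjoint_graph_jacobiOp₀ a (fun n => conj (b n))
  simp only [Complex.conj_conj] at h
  rw [LinearPMap.IsClosed, ← h]
  exact Submodule.isClosed_adjoint _

/-- **Properness is equivalent to the adjoint relation `J(a,b)* = J(a,b*)`**
(Corollary 2.3): the adjoint of the maximal Jacobi operator equals the maximal operator of
the conjugated coefficients iff the closure of the minimal operator `J₀(a,b)` equals the
maximal operator `J(a,b)`. -/
theorem adjoint_eq_iff_proper (a : ℕ → ℝ) (ha : ∀ n, 0 < a n) (b : ℕ → ℂ) :
    (jacobiOp a b).adjoint = jacobiOp a (fun n => conj (b n)) ↔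
      (jacobiOp₀ a b).closure = jacobiOp a b := by
  have hclosed := isClosed_jacobiOp a b
  have hclosure := (hclosed.isClosable.leIsClosable
    (jacobiOp₀_le_jacobiOp a b)).graph_closure_eq_closure_graph
  have hadjoint := LinearPMap.adjoint_graph_eq_graph_adjoint (dense_jacobiOp_domain a b)
  constructor
  · intro h
    apply LinearPMap.eq_of_eq_graph
    rw [← hclosure, ← Submodule.adjoint_adjoint, adjoint_graph_jacobiOp₀, ← h, hadjoint,
      Submodule.adjoint_adjoint, hclosed.submodule_topologicalClosure_eq]
  · intro h
    apply LinearPMap.eq_of_eq_graph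
    rw [hadjoint, ← h, ← hclosure, Submodule.adjoint_topologicalClosure, adjoint_graph_jacobiOp₀]

end
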